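/- There is no function θ ∈ C⁴([−L,L]) (L > 0) such that θ(x) > 0 for all x ∈ (−L,L), θ(−L) = θ(L) = 0, and θ satisfies the fourth-order blow-up profile equation (1/2)·θ(x) = θ(x)²·(−θ⁗(x) + θ(x)) for all x ∈ (−L,L). -/

import Mathlib

/-- Nonexistence of positive separable blow-up profiles for the fourth-order
reaction-diffusion equation `u_t = u²(−u_xxxx + u)` on `[-L, L]` with Dirichlet
vanishing at the endpoints: there is no `θ ∈ C⁴([−L,L])` with `θ > 0` on `(−L,L)`,
`θ(±L) = 0`, satisfying `(1/2)θ = θ²(−θ⁗ + θ)` on `(−L,L)`. -/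
theorem no_fourth_order_blowup_profile_interval (L : ℝ) (hL : 0 < L) :
    ¬ ∃ θ : ℝ → ℝ,
      ContDiffOn ℝ 4 θ (Set.Icc (-L) L) ∧
      (∀ x ∈ Set.Ioo (-L) L, 0 < θ x) ∧
      θ (-L) = 0 ∧ θ L = 0 ∧
      (∀ x ∈ Set.Ioo (-L) L,
        (1/2 : ℝ) * θ x
          = (θ x)^2 * (-(iteratedDerivWithin 4 θ (Set.Icc (-L) L) x) + θ x)) := by
  rintro ⟨θ, hθ, hpos, -, hθL, hode⟩
  have hlt : -L < L := by linarith
  have hd : ContinuousOn (iteratedDerivWithin 4 θ (Set.Icc (-L) L)) (Set.Icc (-L) L) :=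
    hθ.continuousOn_iteratedDerivWithin le_rfl (uniqueDiffOn_Icc hlt)
  have hcont : ContinuousOn
      (fun x => θ x * (-(iteratedDerivWithin 4 θ (Set.Icc (-L) L) x) + θ x))
      (Set.Icc (-L) L) :=
    hθ.continuousOn.mul (hd.neg.add hθ.continuousOn)
  have hinterior : Set.EqOn
      (fun x => θ x * (-(iteratedDerivWithin 4 θ (Set.Icc (-L) L) x) + θ x))
      (fun _ => 1 / 2) (Set.Ioo (-L) L) := fun x hx =>
    mul_left_cancel₀ (hpos x hx).ne' (by linear_combination -hode x hx)
  have hclosed := hinterior.of_subset_closure hcont continuousOn_const Set.Ioo_subset_Icc_self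
    (closure_Ioo hlt.ne).ge
  have hend := hclosed (Set.right_mem_Icc.2 hlt.le)
  norm_num [hθL] at hend
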